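/- arXiv:0802.2544 — 2 statements merged into one kernel-verified Lean document; each statement's English description precedes it below -/
import Mathlib

section
/- For every t ∈ (1,∞), ñ_t = (ℝ⁹, μ̃_t) is not an Einstein nilradical: for every g ∈ GL₉(ℝ), writing ν = g·μ̃_t, there exist no c ∈ ℝ and no derivation D of (ℝ⁹, ν) with Ric_ν = c·I + D. -/
open Matrix Finset Real Filter

noncomputable section

/-- The canonical basis vector `eᵢ` of `ℝ⁹` (0-indexed: `e 0 = e₁`, …, `e 8 = e₉`). -/
def e (i : Fin 9) : Fin 9 → ℝ := Pi.single i 1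

/-- Half of the structure constants of `μ_t` (before antisymmetrization):
`μ_t(e₅,e₄)=e₇, μ_t(e₁,e₆)=e₈, μ_t(e₃,e₂)=e₉, μ_t(e₃,e₆)=t e₇, μ_t(e₅,e₂)=t e₈, μ_t(e₁,e₄)=t e₉`. -/
def muHalf (t : ℝ) (i j k : Fin 9) : ℝ :=
  (if i = 4 ∧ j = 3 ∧ k = 6 then (1:ℝ) else 0) +
  (if i = 0 ∧ j = 5 ∧ k = 7 then (1:ℝ) else 0) +
  (if i = 2 ∧ j = 1 ∧ k = 8 then (1:ℝ) else 0) +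
  (if i = 2 ∧ j = 5 ∧ k = 6 then t else 0) +
  (if i = 4 ∧ j = 1 ∧ k = 7 then t else 0) +
  (if i = 0 ∧ j = 3 ∧ k = 8 then t else 0)

/-- The (antisymmetric) structure constants of `μ_t`. -/
def muC (t : ℝ) (i j k : Fin 9) : ℝ := muHalf t i j k - muHalf t j i k

/-- The two-step nilpotent Lie bracket `μ_t` on `ℝ⁹`. -/
def mu (t : ℝ) (X Y : Fin 9 → ℝ) : Fin 9 → ℝ :=
  fun k => ∑ i, ∑ j, X i * Y j * muC t i j k

/-- Structure constants of `μ̃_t`: those of `μ_t` plus `μ̃_t(e₁,e₂)=e₇`. -/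
def muTildeHalf (t : ℝ) (i j k : Fin 9) : ℝ :=
  muHalf t i j k + (if i = 0 ∧ j = 1 ∧ k = 6 then (1:ℝ) else 0)

def muTildeC (t : ℝ) (i j k : Fin 9) : ℝ := muTildeHalf t i j k - muTildeHalf t j i k

/-- The two-step nilpotent Lie bracket `μ̃_t` on `ℝ⁹`. -/
def muTilde (t : ℝ) (X Y : Fin 9 → ℝ) : Fin 9 → ℝ :=
  fun k => ∑ i, ∑ j, X i * Y j * muTildeC t i j k

/-- Structure constants of `μ̄_t`: those of `μ̃_t` plus `μ̄_t(e₃,e₄)=e₈`. -/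
def muBarHalf (t : ℝ) (i j k : Fin 9) : ℝ :=
  muTildeHalf t i j k + (if i = 2 ∧ j = 3 ∧ k = 7 then (1:ℝ) else 0)

def muBarC (t : ℝ) (i j k : Fin 9) : ℝ := muBarHalf t i j k - muBarHalf t j i k

/-- The two-step nilpotent Lie bracket `μ̄_t` on `ℝ⁹`. -/
def muBar (t : ℝ) (X Y : Fin 9 → ℝ) : Fin 9 → ℝ :=
  fun k => ∑ i, ∑ j, X i * Y j * muBarC t i j k

/-- The space of (skew-symmetric bilinear) bracket candidates on `ℝ⁹`,
represented as bare functions. -/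
abbrev NilBracket := (Fin 9 → ℝ) → (Fin 9 → ℝ) → Fin 9 → ℝ

/-- The Ricci operator of `(ℝ⁹, ν)` w.r.t. the canonical inner product, as a matrix in the
canonical basis:
`⟨Ric_ν X, Y⟩ = -(1/2)∑ᵢⱼ⟨ν(X,eᵢ),eⱼ⟩⟨ν(Y,eᵢ),eⱼ⟩ + (1/4)∑ᵢⱼ⟨ν(eᵢ,eⱼ),X⟩⟨ν(eᵢ,eⱼ),Y⟩`. -/
def ric (ν : NilBracket) : Matrix (Fin 9) (Fin 9) ℝ :=
  fun a b =>
    -(1/2) * (∑ i, ∑ j, ν (e a) (e i) j * ν (e b) (e i) j)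
    + (1/4) * (∑ i, ∑ j, ν (e i) (e j) a * ν (e i) (e j) b)

/-- `D` is a derivation of the algebra `(ℝ⁹, ν)`. -/
def IsDerivation (ν : NilBracket) (D : Matrix (Fin 9) (Fin 9) ℝ) : Prop :=
  ∀ X Y : Fin 9 → ℝ, D.mulVec (ν X Y) = ν (D.mulVec X) Y + ν X (D.mulVec Y)

/-- The basis `e₁,…,e₆` of `v = span(e₁,…,e₆) ⊆ ℝ⁹`, indexed by `Fin 6`. -/
def E (a : Fin 6) : Fin 9 → ℝ := e (Fin.castLE (by norm_num) a)

/-- The skew-symmetric 6×6 matrix `J_ν(w)`, `w = x e₇ + y e₈ + z e₉`, defined by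
`⟨J_ν(w) v₁, v₂⟩ = ⟨ν(v₁,v₂), w⟩` for `v₁,v₂ ∈ span(e₁,…,e₆)`. -/
def Jmat (ν : NilBracket) (x y z : ℝ) : Matrix (Fin 6) (Fin 6) ℝ :=
  fun a b => ν (E b) (E a) 6 * x + ν (E b) (E a) 7 * y + ν (E b) (E a) 8 * z

/-- The `GL₉(ℝ)` action on brackets: `(g·ν)(X,Y) = g ν(g⁻¹X, g⁻¹Y)`. -/
def act (g : Matrix (Fin 9) (Fin 9) ℝ) (ν : NilBracket) : NilBracket :=
  fun X Y => g.mulVec (ν (g⁻¹.mulVec X) (g⁻¹.mulVec Y))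

/-- The algebras `(ℝ⁹, ν)` and `(ℝ⁹, ν')` are isomorphic:
there is `g ∈ GL₉(ℝ)` with `g ν(X,Y) = ν'(gX, gY)` for all `X, Y`. -/
def LieIso (ν ν' : NilBracket) : Prop :=
  ∃ g : Matrix (Fin 9) (Fin 9) ℝ, IsUnit g ∧
    ∀ X Y : Fin 9 → ℝ, g.mulVec (ν X Y) = ν' (g.mulVec X) (g.mulVec Y)


section LinearAlgebra

variable {n : ℕ}

/-- A QR decomposition adapted to a flag: every real square matrix is the product of an orthogonal
matrix and a block triangular one. -/
lemma exists_orthogonal_mul_blockTriangular (b : Fin n → ℕ) (g : Matrix (Fin n) (Fin n) ℝ) :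
    ∃ K p : Matrix (Fin n) (Fin n) ℝ, Kᵀ * K = 1 ∧ p.BlockTriangular b ∧ g = K * p := by
  set σ := Tuple.sort b
  have hσ : Monotone (b ∘ σ) := Tuple.monotone_sort b
  let f : Fin n → EuclideanSpace ℝ (Fin n) := fun i => WithLp.toLp 2 (fun k => g k (σ i))
  let u := InnerProductSpace.gramSchmidtOrthonormalBasis (𝕜 := ℝ) (by simp) f
  let K : Matrix (Fin n) (Fin n) ℝ := Matrix.of fun i j => u (σ.symm j) i
  have hK : Kᵀ * K = 1 := by
    ext i j
    have h := orthonormal_iff_ite.mp u.orthonormal (σ.symm j) (σ.symm i)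
    rw [PiLp.inner_apply] at h
    simp only [Matrix.mul_apply, Matrix.transpose_apply, K, Matrix.of_apply, Matrix.one_apply]
    simpa [eq_comm] using h
  refine ⟨K, Kᵀ * g, hK, ?_, ?_⟩
  · intro i j hij
    have hlt : σ.symm j < σ.symm i := by
      by_contra hle
      have := hσ (not_lt.mp hle)
      simp only [Function.comp_apply, Equiv.apply_symm_apply] at this
      omega
    have h := InnerProductSpace.gramSchmidtOrthonormalBasis_inv_triangular (𝕜 := ℝ)
      (by simp) f hlt
    rw [PiLp.inner_apply] at h
    simp only [Matrix.mul_apply, Matrix.transpose_apply, K, Matrix.of_apply]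
    simpa [f, u, mul_comm] using h
  · rw [← Matrix.mul_assoc, mul_eq_one_comm.mp hK, Matrix.one_mul]

lemma mul_diagonal_mul_apply_self {b : Fin n → ℕ} {M N : Matrix (Fin n) (Fin n) ℝ}
    (hM : M.BlockTriangular b) (hN : N.BlockTriangular b) (f : ℕ → ℝ) (i : Fin n) :
    (M * (diagonal (fun j => f (b j)) * N)) i i = f (b i) * (M * N) i i := by
  rw [Matrix.mul_apply, Matrix.mul_apply, Finset.mul_sum]
  refine Finset.sum_congr rfl fun j _ => ?_
  rw [Matrix.diagonal_mul]
  rcases lt_trichotomy (b i) (b j) with h | h | h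
  · simp [hN h]
  · rw [h]; ring
  · simp [hM h]

end LinearAlgebra

section Bilinear

/-- Bilinear maps on `ℝ⁹`. -/
abbrev Bilin := (Fin 9 → ℝ) →ₗ[ℝ] (Fin 9 → ℝ) →ₗ[ℝ] (Fin 9 → ℝ)

/-- The bracket underlying a bilinear map. -/
def Bilin.toBracket (β : Bilin) : NilBracket := fun X Y => β X Y

/-- The action of `GL₉(ℝ)` on bilinear maps. -/
def Bilin.act (g : Matrix (Fin 9) (Fin 9) ℝ) (β : Bilin) : Bilin :=
  (β.compl₁₂ (toLin' g⁻¹) (toLin' g⁻¹)).compr₂ (toLin' g)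

lemma Bilin.act_apply (g : Matrix (Fin 9) (Fin 9) ℝ) (β : Bilin) (X Y : Fin 9 → ℝ) :
    β.act g X Y = g *ᵥ β (g⁻¹ *ᵥ X) (g⁻¹ *ᵥ Y) := by
  simp [Bilin.act]

lemma Bilin.act_mul (g h : Matrix (Fin 9) (Fin 9) ℝ) (β : Bilin) :
    β.act (g * h) = (β.act h).act g := by
  refine LinearMap.ext₂ fun X Y => ?_
  simp only [Bilin.act_apply, Matrix.mul_inv_rev, Matrix.mulVec_mulVec]

lemma Bilin.act_skew (g : Matrix (Fin 9) (Fin 9) ℝ) {β : Bilin}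
    (hβ : ∀ X Y, β X Y = -β Y X) (X Y : Fin 9 → ℝ) : β.act g X Y = -β.act g Y X := by
  rw [Bilin.act_apply, Bilin.act_apply, hβ, Matrix.mulVec_neg]

lemma Bilin.act_toBracket (g : Matrix (Fin 9) (Fin 9) ℝ) (β : Bilin) :
    _root_.act g β.toBracket = (β.act g).toBracket := by
  funext X Y
  simp [_root_.act, Bilin.toBracket, Bilin.act_apply]

/-- The infinitesimal action of `A ∈ gl₉(ℝ)` on bilinear maps. -/
def Bilin.defect (A : Matrix (Fin 9) (Fin 9) ℝ) (β : Bilin) : Bilin :=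
  β.compr₂ (toLin' A) - β.compl₁₂ (toLin' A) LinearMap.id - β.compl₁₂ LinearMap.id (toLin' A)

lemma Bilin.defect_apply (A : Matrix (Fin 9) (Fin 9) ℝ) (β : Bilin) (X Y : Fin 9 → ℝ) :
    β.defect A X Y = A *ᵥ β X Y - β (A *ᵥ X) Y - β X (A *ᵥ Y) := by
  simp [Bilin.defect]

lemma Bilin.isDerivation_iff (A : Matrix (Fin 9) (Fin 9) ℝ) (β : Bilin) :
    IsDerivation β.toBracket A ↔ β.defect A = 0 := by
  constructor
  · intro h
    refine LinearMap.ext₂ fun X Y => ?_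
    have := h X Y
    simp only [Bilin.toBracket] at this
    rw [Bilin.defect_apply, this]
    simp
  · intro h X Y
    have := Bilin.defect_apply A β X Y
    rw [h] at this
    simp only [Bilin.toBracket]
    rw [LinearMap.zero_apply, LinearMap.zero_apply, sub_sub, eq_comm, sub_eq_zero] at this
    exact this

lemma Bilin.ext_e {β γ : Bilin} (h : ∀ i j, β (e i) (e j) = γ (e i) (e j)) : β = γ := by
  refine (Pi.basisFun ℝ (Fin 9)).ext fun i => (Pi.basisFun ℝ (Fin 9)).ext fun j => ?_
  simpa [e, Pi.basisFun_apply] using h i j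

lemma Bilin.act_defect {g g' : Matrix (Fin 9) (Fin 9) ℝ} (hg : g' * g = 1)
    (A : Matrix (Fin 9) (Fin 9) ℝ) (β : Bilin) (X Y : Fin 9 → ℝ) :
    (β.act g).defect (g * A * g') X Y = g *ᵥ β.defect A (g' *ᵥ X) (g' *ᵥ Y) := by
  have hinv : g⁻¹ = g' := Matrix.inv_eq_left_inv hg
  simp only [Bilin.defect_apply, Bilin.act_apply, hinv, Matrix.mulVec_mulVec, Matrix.mulVec_sub,
    Matrix.mul_assoc, hg, Matrix.mul_one]
  simp only [← Matrix.mul_assoc, hg, Matrix.one_mul]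

lemma Bilin.act_defect_eq_zero_iff {g g' : Matrix (Fin 9) (Fin 9) ℝ} (hg : g' * g = 1)
    (A : Matrix (Fin 9) (Fin 9) ℝ) (β : Bilin) :
    (β.act g).defect A = 0 ↔ β.defect (g' * A * g) = 0 := by
  have hg' : g * g' = 1 := mul_eq_one_comm.mp hg
  have hA : g * (g' * A * g) * g' = A := by
    rw [Matrix.mul_assoc, Matrix.mul_assoc, hg', Matrix.mul_one, ← Matrix.mul_assoc, hg',
      Matrix.one_mul]
  have key := Bilin.act_defect hg (g' * A * g) β
  rw [hA] at key
  constructor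
  · intro h
    refine LinearMap.ext₂ fun X Y => ?_
    have := congrArg (g' *ᵥ ·) (key (g *ᵥ X) (g *ᵥ Y))
    simpa [h, Matrix.mulVec_mulVec, hg] using this.symm
  · intro h
    refine LinearMap.ext₂ fun X Y => ?_
    rw [key, h]
    simp

lemma sum_mulVec_dotProduct (M N : Matrix (Fin 9) (Fin 9) ℝ) :
    ∑ i, (M *ᵥ e i) ⬝ᵥ (N *ᵥ e i) = trace (Mᵀ * N) := by
  simp [Matrix.trace, Matrix.mul_apply, e, dotProduct]

lemma sum_orthogonal_dotProduct {K : Matrix (Fin 9) (Fin 9) ℝ} (hK : K * Kᵀ = 1)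
    (f g : (Fin 9 → ℝ) →ₗ[ℝ] (Fin 9 → ℝ)) :
    ∑ i, f (K *ᵥ e i) ⬝ᵥ g (K *ᵥ e i) = ∑ i, f (e i) ⬝ᵥ g (e i) := by
  obtain ⟨M, rfl⟩ := toLin'.surjective f
  obtain ⟨N, rfl⟩ := toLin'.surjective g
  simp only [Matrix.toLin'_apply, Matrix.mulVec_mulVec, sum_mulVec_dotProduct]
  rw [Matrix.transpose_mul, Matrix.mul_assoc, Matrix.trace_mul_comm, Matrix.mul_assoc,
    Matrix.mul_assoc, hK, Matrix.mul_one]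

lemma mulVec_e (A : Matrix (Fin 9) (Fin 9) ℝ) (i : Fin 9) : A *ᵥ e i = ∑ a, A a i • e a := by
  ext k
  simp [e, Pi.single_apply]

/-- The Ricci operator is, up to a factor `4`, the moment map of the `GL₉(ℝ)`-action. -/
lemma trace_ric_mul (β : Bilin) (hβ : ∀ X Y, β X Y = -β Y X) (A : Matrix (Fin 9) (Fin 9) ℝ) :
    trace (ric β.toBracket * A) =
      (1 / 4) * ∑ i, ∑ j, β (e i) (e j) ⬝ᵥ β.defect A (e i) (e j) := by
  have h1 : ∑ i, ∑ j, β (e i) (e j) ⬝ᵥ β (A *ᵥ e i) (e j) =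
      ∑ a, ∑ b, (∑ i, ∑ j, β (e a) (e i) j * β (e b) (e i) j) * A b a := by
    refine Finset.sum_congr rfl fun a _ => ?_
    simp only [mulVec_e, map_sum, map_smul, LinearMap.sum_apply, LinearMap.smul_apply,
      dotProduct_sum, dotProduct_smul, smul_eq_mul]
    rw [Finset.sum_comm]
    refine Finset.sum_congr rfl fun b _ => ?_
    simp only [dotProduct, Finset.sum_mul, Finset.mul_sum]
    refine Finset.sum_congr rfl fun i _ => Finset.sum_congr rfl fun j _ => ?_
    ring
  have h2 : ∑ i, ∑ j, β (e i) (e j) ⬝ᵥ β (e i) (A *ᵥ e j) =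
      ∑ i, ∑ j, β (e i) (e j) ⬝ᵥ β (A *ᵥ e i) (e j) := by
    rw [Finset.sum_comm]
    refine Finset.sum_congr rfl fun i _ => Finset.sum_congr rfl fun j _ => ?_
    rw [hβ (e j) (e i), hβ (e j) (A *ᵥ e i), neg_dotProduct_neg]
  have h3 : ∑ i, ∑ j, β (e i) (e j) ⬝ᵥ (A *ᵥ β (e i) (e j)) =
      ∑ a, ∑ b, (∑ i, ∑ j, β (e i) (e j) a * β (e i) (e j) b) * A b a := by
    have : ∀ i j, β (e i) (e j) ⬝ᵥ (A *ᵥ β (e i) (e j)) =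
        ∑ a, ∑ b, (β (e i) (e j) a * β (e i) (e j) b) * A b a := by
      intro i j
      rw [Finset.sum_comm]
      simp only [dotProduct, mulVec, Finset.mul_sum]
      refine Finset.sum_congr rfl fun a _ => Finset.sum_congr rfl fun b _ => ?_
      ring
    simp only [this, Finset.sum_mul]
    calc _ = ∑ i, ∑ a, ∑ j, ∑ b, (β (e i) (e j) a * β (e i) (e j) b) * A b a :=
          Finset.sum_congr rfl fun i _ => Finset.sum_comm
      _ = ∑ a, ∑ i, ∑ b, ∑ j, (β (e i) (e j) a * β (e i) (e j) b) * A b a := by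
          rw [Finset.sum_comm]
          exact Finset.sum_congr rfl fun a _ => Finset.sum_congr rfl fun i _ => Finset.sum_comm
      _ = _ := Finset.sum_congr rfl fun a _ => Finset.sum_comm
  simp only [Bilin.defect_apply, dotProduct_sub, Finset.sum_sub_distrib, h2, h1, h3]
  simp only [Matrix.trace, Matrix.diag_apply, Matrix.mul_apply, ric, Bilin.toBracket, add_mul,
    Finset.sum_add_distrib, mul_assoc, ← Finset.mul_sum]
  ring

lemma trace_ric_orthogonal {K : Matrix (Fin 9) (Fin 9) ℝ} (hK : Kᵀ * K = 1) (β : Bilin)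
    (hβ : ∀ X Y, β X Y = -β Y X) (A : Matrix (Fin 9) (Fin 9) ℝ) :
    trace (ric (β.act K).toBracket * (K * A * Kᵀ)) = trace (ric β.toBracket * A) := by
  have hinv : K⁻¹ = Kᵀ := Matrix.inv_eq_left_inv hK
  have hT : Kᵀ * (Kᵀ)ᵀ = 1 := by rw [Matrix.transpose_transpose, hK]
  rw [trace_ric_mul _ (Bilin.act_skew K hβ), trace_ric_mul _ hβ]
  congr 1
  have key : ∀ X Y, β.act K X Y ⬝ᵥ (β.act K).defect (K * A * Kᵀ) X Y =
      β (Kᵀ *ᵥ X) (Kᵀ *ᵥ Y) ⬝ᵥ β.defect A (Kᵀ *ᵥ X) (Kᵀ *ᵥ Y) := by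
    intro X Y
    rw [Bilin.act_defect hK, Bilin.act_apply, hinv, Matrix.dotProduct_mulVec,
      Matrix.vecMul_mulVec, hK, Matrix.vecMul_one]
  simp only [key]
  calc _ = ∑ i, ∑ j, β (Kᵀ *ᵥ e i) (e j) ⬝ᵥ β.defect A (Kᵀ *ᵥ e i) (e j) :=
        Finset.sum_congr rfl fun i _ => sum_orthogonal_dotProduct hT _ _
    _ = _ := by
        rw [Finset.sum_comm]
        conv_rhs => rw [Finset.sum_comm]
        exact Finset.sum_congr rfl fun j _ =>
          sum_orthogonal_dotProduct hT (β.flip (e j)) ((β.defect A).flip (e j))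

/-- If the bracket `β` has only nonnegative weights under a diagonal matrix `H` and `Ric_β` is
orthogonal to `H`, then `H` is a derivation of `β`. -/
lemma defect_diagonal_eq_zero (β : Bilin) (hβ : ∀ X Y, β X Y = -β Y X) (h : Fin 9 → ℝ)
    (hpos : ∀ i j k, β (e i) (e j) k = 0 ∨ 0 ≤ h k - h i - h j)
    (htr : trace (ric β.toBracket * diagonal h) = 0) : β.defect (diagonal h) = 0 := by
  have hval : ∀ i j k, β.defect (diagonal h) (e i) (e j) k =
      (h k - h i - h j) * β (e i) (e j) k := by
    intro i j k
    have he : ∀ i, diagonal h *ᵥ e i = h i • e i := fun i => by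
      ext m
      rw [Matrix.mulVec_diagonal]
      by_cases hm : m = i
      · simp [hm, e]
      · simp [hm, e]
    rw [Bilin.defect_apply, he, he, map_smul, map_smul, LinearMap.smul_apply]
    simp only [Pi.sub_apply, Pi.smul_apply, Matrix.mulVec_diagonal, smul_eq_mul]
    ring
  have hnn : ∀ i j k, 0 ≤ β (e i) (e j) k * β.defect (diagonal h) (e i) (e j) k := by
    intro i j k
    rw [hval]
    rcases hpos i j k with h0 | h0
    · simp [h0]
    · nlinarith [mul_nonneg h0 (mul_self_nonneg (β (e i) (e j) k))]
  rw [trace_ric_mul β hβ] at htr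
  have hsum : ∑ i, ∑ j, ∑ k, β (e i) (e j) k * β.defect (diagonal h) (e i) (e j) k = 0 := by
    simpa [dotProduct] using htr
  refine Bilin.ext_e fun i j => ?_
  funext k
  have h1 := (Finset.sum_eq_zero_iff_of_nonneg fun i _ => Finset.sum_nonneg fun j _ =>
    Finset.sum_nonneg fun k _ => hnn i j k).mp hsum i (Finset.mem_univ i)
  have h2 := (Finset.sum_eq_zero_iff_of_nonneg fun j _ =>
    Finset.sum_nonneg fun k _ => hnn i j k).mp h1 j (Finset.mem_univ j)
  have h3 := (Finset.sum_eq_zero_iff_of_nonneg fun k _ => hnn i j k).mp h2 k (Finset.mem_univ k)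
  rcases mul_eq_zero.mp h3 with h4 | h4
  · simp [hval, h4]
  · simpa using h4

end Bilinear

section MuTilde

/-- `μ̃_t` as a bilinear map. -/
def muTildeBilin (t : ℝ) : Bilin :=
  LinearMap.mk₂ ℝ (muTilde t)
    (fun X X' Y => by
      funext k; simp only [muTilde, Pi.add_apply, add_mul, Finset.sum_add_distrib])
    (fun r X Y => by
      funext k; simp only [muTilde, Pi.smul_apply, smul_eq_mul, Finset.mul_sum, mul_assoc])
    (fun X Y Y' => by
      funext k; simp only [muTilde, Pi.add_apply, mul_add, add_mul, Finset.sum_add_distrib])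
    (fun r X Y => by
      funext k
      simp only [muTilde, Pi.smul_apply, smul_eq_mul, Finset.mul_sum, mul_assoc, mul_left_comm])

lemma muTildeBilin_apply (t : ℝ) (X Y : Fin 9 → ℝ) : muTildeBilin t X Y = muTilde t X Y := rfl

lemma muTildeBilin_toBracket (t : ℝ) : (muTildeBilin t).toBracket = muTilde t := rfl

lemma muTildeBilin_skew (t : ℝ) (X Y : Fin 9 → ℝ) :
    muTildeBilin t X Y = -muTildeBilin t Y X := by
  funext k
  simp only [muTildeBilin_apply, muTilde, Pi.neg_apply]
  rw [Finset.sum_comm, ← Finset.sum_neg_distrib]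
  refine Finset.sum_congr rfl fun i _ => ?_
  rw [← Finset.sum_neg_distrib]
  refine Finset.sum_congr rfl fun j _ => ?_
  simp only [muTildeC]
  ring

lemma muTilde_eq (t : ℝ) (X Y : Fin 9 → ℝ) : muTilde t X Y =
    ![0, 0, 0, 0, 0, 0,
      X 4 * Y 3 - X 3 * Y 4 + t * (X 2 * Y 5 - X 5 * Y 2) + (X 0 * Y 1 - X 1 * Y 0),
      X 0 * Y 5 - X 5 * Y 0 + t * (X 4 * Y 1 - X 1 * Y 4),
      X 2 * Y 1 - X 1 * Y 2 + t * (X 0 * Y 3 - X 3 * Y 0)] := by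
  have h : ∀ (a b c k : Fin 9) (r : ℝ),
      ∑ i, ∑ j, X i * Y j * (if i = a ∧ j = b ∧ k = c then r else 0) =
        if k = c then X a * Y b * r else 0 := by
    intro a b c k r
    rw [Finset.sum_eq_single a, Finset.sum_eq_single b] <;> simp +contextual
  have h' : ∀ (a b c k : Fin 9) (r : ℝ),
      ∑ i, ∑ j, X i * Y j * (if j = a ∧ i = b ∧ k = c then r else 0) =
        if k = c then X b * Y a * r else 0 := by
    intro a b c k r
    rw [Finset.sum_eq_single b, Finset.sum_eq_single a] <;> simp +contextual
  funext k
  simp only [muTilde, muTildeC, muTildeHalf, muHalf, mul_add, mul_sub, Finset.sum_add_distrib,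
    Finset.sum_sub_distrib, h, h']
  fin_cases k <;> simp <;> ring

/-- The block structure of the flag `⟨e₇⟩ ⊂ ⟨e₃,…,e₉⟩ ⊂ ℝ⁹`. -/
def flagIdx : Fin 9 → ℕ := ![2, 2, 1, 1, 1, 1, 0, 1, 1]

/-- The diagonal matrix with eigenvalue `i` on the `i`-th graded piece of the flag `flagIdx`. -/
def flagGrading : Matrix (Fin 9) (Fin 9) ℝ := diagonal fun i => (2 : ℝ) - flagIdx i

/-- The derivation defining the grading `⟨e₁,…,e₆⟩ ⊕ ⟨e₇,e₈,e₉⟩`. -/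
def stdGrading : Matrix (Fin 9) (Fin 9) ℝ := diagonal ![1, 1, 1, 1, 1, 1, 2, 2, 2]

/-- The generator of the one-parameter subgroup of `SL₆(ℝ) × SL₃(ℝ)` degenerating `μ̃_t` to `μ_t`
is diagonal with these entries. -/
def degenWeight : Fin 9 → ℝ := ![-2, -2, 1, 1, 1, 1, 2, -1, -1]

lemma muTildeHalf_flag {t : ℝ} {i j k : Fin 9}
    (h : ¬ flagIdx k + 2 ≤ flagIdx i + flagIdx j) : muTildeHalf t i j k = 0 := by
  have h' : ∀ a b c : Fin 9, flagIdx c + 2 ≤ flagIdx a + flagIdx b →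
      ¬ (i = a ∧ j = b ∧ k = c) := by
    rintro a b c habc ⟨rfl, rfl, rfl⟩
    exact h habc
  simp [muTildeHalf, muHalf, h' 4 3 6 (by decide), h' 0 5 7 (by decide), h' 2 1 8 (by decide),
    h' 2 5 6 (by decide), h' 4 1 7 (by decide), h' 0 3 8 (by decide), h' 0 1 6 (by decide)]

lemma muTildeC_flag {t : ℝ} {i j k : Fin 9}
    (h : ¬ flagIdx k + 2 ≤ flagIdx i + flagIdx j) : muTildeC t i j k = 0 := by
  rw [muTildeC, muTildeHalf_flag h, muTildeHalf_flag (by rwa [add_comm (flagIdx j)]), sub_zero]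

lemma act_muTilde_flag {t : ℝ} {p : Matrix (Fin 9) (Fin 9) ℝ} (hp : p.BlockTriangular flagIdx)
    (hp' : p⁻¹.BlockTriangular flagIdx) {i j k : Fin 9}
    (h : ¬ flagIdx k + 2 ≤ flagIdx i + flagIdx j) :
    (muTildeBilin t).act p (e i) (e j) k = 0 := by
  rw [Bilin.act_apply, muTildeBilin_apply]
  change ∑ m, p k m * muTilde t (p⁻¹ *ᵥ e i) (p⁻¹ *ᵥ e j) m = 0
  refine Finset.sum_eq_zero fun m _ => ?_
  by_cases hm : flagIdx m < flagIdx k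
  · simp [hp hm]
  rw [muTilde, Finset.sum_eq_zero, mul_zero]
  refine fun a _ => Finset.sum_eq_zero fun c _ => ?_
  by_cases ha : flagIdx i < flagIdx a
  · simp [e, hp' ha]
  by_cases hc : flagIdx j < flagIdx c
  · simp [e, hp' hc]
  rw [muTildeC_flag (by omega), mul_zero]

lemma defect_stdGrading (t : ℝ) : (muTildeBilin t).defect stdGrading = 0 := by
  refine LinearMap.ext₂ fun X Y => ?_
  rw [Bilin.defect_apply]
  simp only [muTildeBilin_apply, stdGrading, muTilde_eq]
  funext k
  simp only [Pi.sub_apply, Matrix.mulVec_diagonal]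
  fin_cases k <;> simp <;> ring

lemma muTilde_derivation_apply {t : ℝ} {D : Matrix (Fin 9) (Fin 9) ℝ}
    (hD : (muTildeBilin t).defect D = 0) (i j k : Fin 9) :
    D k 6 * muTilde t (e i) (e j) 6 + D k 7 * muTilde t (e i) (e j) 7 +
        D k 8 * muTilde t (e i) (e j) 8 =
      muTilde t (fun m => D m i) (e j) k + muTilde t (e i) (fun m => D m j) k := by
  have h := congrFun (((muTildeBilin t).isDerivation_iff D).mpr hD (e i) (e j)) k
  have hcol : ∀ i, D *ᵥ e i = fun m => D m i := fun i => by ext; simp [e]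
  rw [muTildeBilin_toBracket, hcol, hcol, Pi.add_apply] at h
  rw [← h]
  simp [muTilde_eq, Matrix.mulVec, dotProduct, Fin.sum_univ_succ, add_assoc]

/-- Derivations of `μ̃_t` preserve the flag and are orthogonal to the degenerating direction. -/
lemma muTilde_derivation {t : ℝ} (ht : 1 < t) {D : Matrix (Fin 9) (Fin 9) ℝ}
    (hD : (muTildeBilin t).defect D = 0) :
    D.BlockTriangular flagIdx ∧ ∑ i, degenWeight i * D i i = 0 := by
  have ht0 : t ≠ 0 := by positivity
  have ht3 : 1 + t ^ 3 ≠ 0 := by positivity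
  have E := muTilde_derivation_apply hD
  simp only [muTilde_eq] at E
  have h06 : D 0 6 = 0 := by simpa [e, ht0] using E 0 1 0
  have h16 : D 1 6 = 0 := by simpa [e, ht0] using E 0 1 1
  have h26 : D 2 6 = 0 := by simpa [e, ht0] using E 0 1 2
  have h36 : D 3 6 = 0 := by simpa [e, ht0] using E 0 1 3
  have h46 : D 4 6 = 0 := by simpa [e, ht0] using E 0 1 4
  have h56 : D 5 6 = 0 := by simpa [e, ht0] using E 0 1 5
  have h07 : D 0 7 = 0 := by simpa [e, ht0] using E 0 5 0
  have h17 : D 1 7 = 0 := by simpa [e, ht0] using E 0 5 1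
  have h08 : D 0 8 = 0 := by simpa [e, ht0] using E 1 2 0
  have h18 : D 1 8 = 0 := by simpa [e, ht0] using E 1 2 1
  have h03 : D 0 3 = 0 := by simpa [e, ht0, eq_comm] using E 3 5 7
  have h05 : D 0 5 = 0 := by simpa [e, ht0, eq_comm] using E 3 5 8
  have h12 : D 1 2 = 0 := by simpa [e, ht0, eq_comm] using E 2 4 7
  have h14 : D 1 4 = 0 := by simpa [e, ht0, eq_comm] using E 2 4 8
  have r1 : t * D 0 2 + D 1 3 = 0 := by
    have := E 2 3 8
    simp [e] at this
    linarith
  have r2 : D 7 6 * t = D 0 2 := by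
    have := E 2 5 7
    simp [e] at this
    linarith
  have r3 : D 7 6 = t * D 1 3 := by
    have := E 3 4 7
    simp [e] at this
    linarith
  have r4 : D 8 6 * t = D 1 5 := by
    have := E 2 5 8
    simp [e] at this
    linarith
  have r5 : D 8 6 = t * D 0 4 := by
    have := E 3 4 8
    simp [e] at this
    linarith
  have r6 : D 0 4 + t * D 1 5 = 0 := by
    have := E 4 5 7
    simp [e] at this
    linarith
  have s1 : D 6 6 = D 0 0 + D 1 1 := by
    have := E 0 1 6
    simp [e] at this
    linarith
  have s2 : D 6 6 = D 3 3 + D 4 4 := by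
    have := E 3 4 6
    simp [e] at this
    linarith
  have s3 : D 6 6 = D 2 2 + D 5 5 := by
    have := E 2 5 6
    simp [e] at this
    exact mul_left_cancel₀ ht0 (by linarith)
  have s4 : D 7 7 = D 0 0 + D 5 5 := by
    have := E 0 5 7
    simp [e] at this
    linarith
  have s5 : D 8 8 = D 1 1 + D 2 2 := by
    have := E 1 2 8
    simp [e] at this
    linarith
  have h02 : D 0 2 = 0 := mul_left_cancel₀ ht3 (by linear_combination t ^ 2 * r1 - r2 + t * r3)
  have h13 : D 1 3 = 0 := by simpa [h02] using r1
  have h76 : D 7 6 = 0 := by simpa [h13] using r3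
  have h04 : D 0 4 = 0 := mul_left_cancel₀ ht3 (by linear_combination r6 + t * r4 - t ^ 2 * r5)
  have h86 : D 8 6 = 0 := by simpa [h04] using r5
  have h15 : D 1 5 = 0 := by simpa [h86] using r4.symm
  refine ⟨?_, ?_⟩
  · intro i j hij
    fin_cases i <;> fin_cases j <;> first | assumption | exact absurd hij (by decide)
  · simp only [degenWeight, Fin.sum_univ_succ]
    simp
    linarith

end MuTilde

/-- for `t ∈ (1,∞)`, `ñ_t = (ℝ⁹, μ̃_t)` is not an Einstein nilradical:
for every `g ∈ GL₉(ℝ)`, the bracket `ν = g·μ̃_t` admits no `c ∈ ℝ` and derivation `D`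
with `Ric_ν = c·I + D`. -/
theorem statement13 (t : ℝ) (ht : t ∈ Set.Ioi (1:ℝ)) :
    ∀ g : Matrix (Fin 9) (Fin 9) ℝ, IsUnit g →
      ¬ ∃ (c : ℝ) (D : Matrix (Fin 9) (Fin 9) ℝ),
        IsDerivation (act g (muTilde t)) D ∧
        ric (act g (muTilde t)) = c • (1 : Matrix (Fin 9) (Fin 9) ℝ) + D := by
  rintro g hg ⟨c, D, hD, hric⟩
  obtain ⟨K, p, hK, hp, rfl⟩ := exists_orthogonal_mul_blockTriangular flagIdx g
  have hpu : IsUnit p.det := by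
    rw [Matrix.isUnit_iff_isUnit_det, Matrix.det_mul] at hg
    exact isUnit_of_mul_isUnit_right hg
  have hqp : p⁻¹ * p = 1 := Matrix.nonsing_inv_mul p hpu
  have hpq : p * p⁻¹ = 1 := Matrix.mul_nonsing_inv p hpu
  have hq : p⁻¹.BlockTriangular flagIdx := by
    have := Matrix.invertibleOfIsUnitDet p hpu
    exact Matrix.blockTriangular_inv_of_blockTriangular hp
  set β := muTildeBilin t
  have hskew : ∀ X Y, β.act p X Y = -β.act p Y X := Bilin.act_skew p (muTildeBilin_skew t)
  rw [← muTildeBilin_toBracket, Bilin.act_toBracket, Bilin.act_mul] at hD hric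
  rw [Bilin.isDerivation_iff, Bilin.act_defect_eq_zero_iff hK] at hD
  set D₁ := Kᵀ * D * K with hD₁
  have hT : ∀ A, trace (ric (β.act p).toBracket * A) = c * trace A + trace (D₁ * A) := by
    intro A
    rw [← trace_ric_orthogonal hK _ hskew, hric, add_mul, Matrix.trace_add, smul_mul_assoc,
      Matrix.one_mul, Matrix.trace_smul, Matrix.trace_mul_comm (K * A), ← Matrix.mul_assoc, hK,
      Matrix.one_mul, ← Matrix.mul_assoc, Matrix.trace_mul_comm, hD₁]
    simp only [Matrix.mul_assoc, smul_eq_mul]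
  rw [Bilin.act_defect_eq_zero_iff hqp] at hD
  set D₂ := p⁻¹ * D₁ * p with hD₂
  obtain ⟨hD₂_flag, hD₂_weight⟩ := muTilde_derivation ht hD
  have hS : c * 12 + trace (D₂ * stdGrading) = 0 := by
    have hder : (β.act p).defect (p * stdGrading * p⁻¹) = 0 := by
      rw [Bilin.act_defect_eq_zero_iff hqp]
      have : p⁻¹ * (p * stdGrading * p⁻¹) * p = stdGrading := by
        rw [Matrix.mul_assoc, Matrix.mul_assoc, hqp, Matrix.mul_one, ← Matrix.mul_assoc, hqp,
          Matrix.one_mul]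
      rw [this]
      exact defect_stdGrading t
    have h0 := hT (p * stdGrading * p⁻¹)
    rw [trace_ric_mul _ hskew, hder] at h0
    have h1 : trace (p * stdGrading * p⁻¹) = 12 := by
      rw [Matrix.trace_mul_comm, ← Matrix.mul_assoc, hqp, Matrix.one_mul, stdGrading,
        Matrix.trace_diagonal]
      simp [Fin.sum_univ_succ]
      norm_num
    have h2 : trace (D₁ * (p * stdGrading * p⁻¹)) = trace (D₂ * stdGrading) := by
      rw [← Matrix.mul_assoc, Matrix.trace_mul_comm, hD₂]
      simp only [Matrix.mul_assoc]
    rw [h1, h2] at h0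
    simpa using h0.symm
  have hH : trace (ric (β.act p).toBracket * flagGrading) = 0 := by
    have h1 : trace (D₁ * flagGrading) = ∑ i, ((2 : ℝ) - flagIdx i) * D₂ i i := by
      have h2 : trace (D₁ * flagGrading) = trace (D₂ * p⁻¹ * (flagGrading * p)) := by
        rw [hD₂, Matrix.mul_assoc _ p, hpq, Matrix.mul_one, Matrix.mul_assoc p⁻¹,
          Matrix.trace_mul_comm p⁻¹, ← Matrix.mul_assoc, Matrix.mul_assoc _ p, hpq, Matrix.mul_one]
      rw [h2]
      refine Finset.sum_congr rfl fun i _ => ?_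
      have := mul_diagonal_mul_apply_self (hD₂_flag.mul hq) hp (fun m => (2 : ℝ) - m) i
      rwa [Matrix.mul_assoc D₂ p⁻¹ p, hqp, Matrix.mul_one] at this
    have h3 : trace flagGrading = 8 := by
      rw [flagGrading, Matrix.trace_diagonal]
      simp [Fin.sum_univ_succ, flagIdx]
      norm_num
    rw [hT, h1, h3]
    rw [stdGrading, Matrix.trace] at hS
    simp [Fin.sum_univ_succ, Matrix.mul_diagonal] at hS
    simp [Fin.sum_univ_succ, degenWeight] at hD₂_weight
    simp [Fin.sum_univ_succ, flagIdx]
    linarith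
  have hder := defect_diagonal_eq_zero _ hskew (fun i => (2 : ℝ) - flagIdx i) (fun i j k => by
    by_cases h : flagIdx k + 2 ≤ flagIdx i + flagIdx j
    · right
      have : (flagIdx k : ℝ) + 2 ≤ flagIdx i + flagIdx j := by exact_mod_cast h
      linarith
    · exact Or.inl (act_muTilde_flag hp hq h)) hH
  rw [Bilin.act_defect_eq_zero_iff hqp] at hder
  have hsum := (muTilde_derivation ht hder).2
  have hdiag : ∀ i, (p⁻¹ * diagonal (fun i => (2 : ℝ) - flagIdx i) * p) i i =
      (2 : ℝ) - flagIdx i := by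
    intro i
    rw [Matrix.mul_assoc, mul_diagonal_mul_apply_self hq hp (fun m => (2 : ℝ) - m) i, hqp,
      Matrix.one_apply_eq, mul_one]
  simp only [hdiag] at hsum
  simp [Fin.sum_univ_succ, degenWeight, flagIdx] at hsum
  norm_num at hsum
end
end

section
/- For all t, s ∈ (1,∞), the Lie algebra n̄_t = (ℝ⁹, μ̄_t) is isomorphic neither to n_s = (ℝ⁹, μ_s) nor to ñ_s = (ℝ⁹, μ̃_s). -/
open Matrix Finset Real Filter

noncomputable section

/-- Each `muBar t X Y` lies in the span of `e₇, e₈, e₉`, with explicit coordinates. -/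
lemma muBar_eq (t : ℝ) (X Y : Fin 9 → ℝ) :
    muBar t X Y = ![0, 0, 0, 0, 0, 0,
      X 4 * Y 3 - X 3 * Y 4 + t * (X 2 * Y 5 - X 5 * Y 2) + (X 0 * Y 1 - X 1 * Y 0),
      X 0 * Y 5 - X 5 * Y 0 + t * (X 4 * Y 1 - X 1 * Y 4) + (X 2 * Y 3 - X 3 * Y 2),
      X 2 * Y 1 - X 1 * Y 2 + t * (X 0 * Y 3 - X 3 * Y 0)] := by
  funext k
  fin_cases k <;>
    simp [muBar, muBarC, muBarHalf, muTildeHalf, muHalf, Fin.sum_univ_succ] <;> ring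

lemma mu_apply_seven (t : ℝ) (X Y : Fin 9 → ℝ) :
    mu t X Y 7 = X 0 * Y 5 - X 5 * Y 0 + t * (X 4 * Y 1 - X 1 * Y 4) := by
  simp [mu, muC, muHalf, Fin.sum_univ_succ]; ring

lemma mu_apply_eight (t : ℝ) (X Y : Fin 9 → ℝ) :
    mu t X Y 8 = X 2 * Y 1 - X 1 * Y 2 + t * (X 0 * Y 3 - X 3 * Y 0) := by
  simp [mu, muC, muHalf, Fin.sum_univ_succ]; ring

lemma muTilde_apply_seven (t : ℝ) (X Y : Fin 9 → ℝ) : muTilde t X Y 7 = mu t X Y 7 := by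
  simp [muTilde, muTildeC, muTildeHalf, mu, muC]

lemma muTilde_apply_eight (t : ℝ) (X Y : Fin 9 → ℝ) : muTilde t X Y 8 = mu t X Y 8 := by
  simp [muTilde, muTildeC, muTildeHalf, mu, muC]

/-- If the form `p e₇* + q e₈* + r e₉*` composed with `muBar t` has a non-central vector in its
radical, then its Pfaffian, a nodal cubic in `(p, q, r)`, vanishes. -/
lemma pfaffian_muBar_eq_zero (t p q r : ℝ) (X W : Fin 9 → ℝ)
    (h : ∀ Y, p * muBar t X Y 6 + q * muBar t X Y 7 + r * muBar t X Y 8 = 0)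
    (hW : muBar t X W ≠ 0) :
    (1 + t ^ 3) * (p * q * r) - t * p ^ 3 - t * q ^ 3 = 0 := by
  by_contra hf
  have h0 := h (e 0)
  have h1 := h (e 1)
  have h2 := h (e 2)
  have h3 := h (e 3)
  have h4 := h (e 4)
  have h5 := h (e 5)
  simp [muBar_eq, e] at h0 h1 h2 h3 h4 h5
  apply hW
  have x0 : X 0 = 0 := by
    refine (mul_eq_zero.mp ?_).resolve_left hf
    linear_combination (-t * p ^ 2) * h1 + t ^ 2 * p * q * h3 + (p * r - t * q ^ 2) * h5
  have x2 : X 2 = 0 := by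
    refine (mul_eq_zero.mp ?_).resolve_left hf
    linear_combination p * q * h1 - t * q ^ 2 * h3 + (t ^ 2 * q * r - p ^ 2) * h5
  have x4 : X 4 = 0 := by
    refine (mul_eq_zero.mp ?_).resolve_left hf
    linear_combination (t ^ 2 * p * r - q ^ 2) * h1 + (q * r - t * p ^ 2) * h3 + (p * q - t * r ^ 2) * h5
  have x1 : X 1 = 0 := by
    refine (mul_eq_zero.mp ?_).resolve_left hf
    linear_combination t * p ^ 2 * h0 - p * q * h2 - (t ^ 2 * p * r - q ^ 2) * h4
  have x3 : X 3 = 0 := by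
    refine (mul_eq_zero.mp ?_).resolve_left hf
    linear_combination -(t ^ 2 * p * q) * h0 + t * q ^ 2 * h2 - (q * r - t * p ^ 2) * h4
  have x5 : X 5 = 0 := by
    refine (mul_eq_zero.mp ?_).resolve_left hf
    linear_combination -(p * r - t * q ^ 2) * h0 - (t ^ 2 * q * r - p ^ 2) * h2 - (p * q - t * r ^ 2) * h4
  rw [muBar_eq, x0, x1, x2, x3, x4, x5]
  funext k
  fin_cases k <;> simp

lemma exists_ne_zero_mul_add_mul_eq_zero (a b : ℝ) :
    ∃ y z : ℝ, (y ≠ 0 ∨ z ≠ 0) ∧ y * a + z * b = 0 := by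
  by_cases h : a = 0
  · exact ⟨1, 0, by simp, by simp [h]⟩
  · exact ⟨b, -a, by simp [h], by ring⟩

/-- The nodal cubic `(1 + t³) x y z = t x³ + t y³` contains no line of the projective plane. -/
lemma nodal_cubic_contains_no_line {t : ℝ} (ht : 1 < t) (a b c u v w : ℝ)
    (hinj : ∀ y z : ℝ, y * a + z * u = 0 → y * b + z * v = 0 → y * c + z * w = 0 →
      y = 0 ∧ z = 0)
    (hf : ∀ y z : ℝ, (1 + t ^ 3) * ((y * a + z * u) * (y * b + z * v) * (y * c + z * w))
      - t * (y * a + z * u) ^ 3 - t * (y * b + z * v) ^ 3 = 0) : False := by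
  have ht0 : t ≠ 0 := by positivity
  have ht3 : 1 + t ^ 3 ≠ 0 := by positivity
  obtain ⟨y₁, z₁, hne₁, hb₁⟩ := exists_ne_zero_mul_add_mul_eq_zero b v
  have ha₁ : y₁ * a + z₁ * u = 0 := by
    have := hf y₁ z₁
    simpa [hb₁, ht0] using this
  have hc₁ : y₁ * c + z₁ * w ≠ 0 := fun hc₁ ↦ by
    have := hinj _ _ ha₁ hb₁ hc₁
    tauto
  obtain ⟨y₂, z₂, hne₂, hc₂⟩ := exists_ne_zero_mul_add_mul_eq_zero c w
  have hab₂ : y₂ * a + z₂ * u = -(y₂ * b + z₂ * v) := by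
    have h := hf y₂ z₂
    rw [hc₂] at h
    have hcube : (y₂ * a + z₂ * u) ^ 3 = (-(y₂ * b + z₂ * v)) ^ 3 :=
      mul_left_cancel₀ ht0 (by linear_combination -h)
    exact (show Odd 3 by decide).strictMono_pow.injective hcube
  have hb₂ : y₂ * b + z₂ * v ≠ 0 := fun hb₂ ↦ by
    have := hinj _ _ (by rw [hab₂, hb₂, neg_zero]) hb₂ hc₂
    tauto
  have h := hf (y₁ + y₂) (z₁ + z₂)
  rw [show (y₁ + y₂) * a + (z₁ + z₂) * u = -(y₂ * b + z₂ * v) by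
      linear_combination ha₁ + hab₂,
    show (y₁ + y₂) * b + (z₁ + z₂) * v = y₂ * b + z₂ * v by linear_combination hb₁,
    show (y₁ + y₂) * c + (z₁ + z₂) * w = y₁ * c + z₁ * w by linear_combination hc₂] at h
  have : (1 + t ^ 3) * ((y₂ * b + z₂ * v) ^ 2 * (y₁ * c + z₁ * w)) = 0 := by
    linear_combination -h
  simp [ht3, hb₂, hc₁] at this

/-- A bracket whose last two coordinates agree with those of `mu s` is not isomorphic to
`muBar t`. -/
lemma not_lieIso_muBar {t s : ℝ} (ht : 1 < t) (hs : 1 < s) (ν : NilBracket)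
    (h7 : ∀ X Y, ν X Y 7 = mu s X Y 7) (h8 : ∀ X Y, ν X Y 8 = mu s X Y 8) :
    ¬ LieIso (muBar t) ν := by
  rintro ⟨g, hg, hiso⟩
  have hs0 : s ≠ 0 := by positivity
  have hsurj : ∀ X, ∃ Z, g.mulVec Z = X :=
    Matrix.mulVec_surjective_iff_isUnit.mpr hg
  have key : ∀ (y z : ℝ) (X Y : Fin 9 → ℝ),
      (y * g 7 6 + z * g 8 6) * muBar t X Y 6 + (y * g 7 7 + z * g 8 7) * muBar t X Y 7
        + (y * g 7 8 + z * g 8 8) * muBar t X Y 8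
      = y * mu s (g.mulVec X) (g.mulVec Y) 7 + z * mu s (g.mulVec X) (g.mulVec Y) 8 := by
    intro y z X Y
    rw [← h7, ← h8, ← hiso]
    simp [Matrix.mulVec, dotProduct, Fin.sum_univ_succ, muBar_eq]
    ring
  refine nodal_cubic_contains_no_line ht (g 7 6) (g 7 7) (g 7 8) (g 8 6) (g 8 7) (g 8 8) ?_ ?_
  · intro y z ha hb hc
    have hall : ∀ X Y, y * mu s X Y 7 + z * mu s X Y 8 = 0 := by
      intro X Y
      obtain ⟨X, rfl⟩ := hsurj X
      obtain ⟨Y, rfl⟩ := hsurj Y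
      rw [← key, ha, hb, hc]
      ring
    have hy := hall (e 0) (e 5)
    have hz := hall (e 2) (e 1)
    simp [mu_apply_seven, mu_apply_eight, e] at hy hz
    exact ⟨hy, hz⟩
  · intro y z
    by_cases hyz : y = 0 ∧ z = 0
    · simp [hyz.1, hyz.2]
    obtain ⟨X, hX⟩ := hsurj ((s * y) • e 2 - z • e 4)
    obtain ⟨W, hW⟩ := hsurj (e 1)
    refine pfaffian_muBar_eq_zero t _ _ _ X W (fun Y ↦ ?_) (fun h0 ↦ hyz ?_)
    · rw [key, hX, mu_apply_seven, mu_apply_eight]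
      simp [e]
      ring
    · have h := hiso X W
      rw [h0, hX, hW, Matrix.mulVec_zero] at h
      have hz := h7 ((s * y) • e 2 - z • e 4) (e 1)
      have hy := h8 ((s * y) • e 2 - z • e 4) (e 1)
      rw [← h] at hy hz
      simp [mu_apply_seven, mu_apply_eight, e, hs0] at hy hz
      exact ⟨hy, hz⟩

/-- for `t,s ∈ (1,∞)`, `n̄_t = (ℝ⁹, μ̄_t)` is isomorphic neither to
`n_s = (ℝ⁹, μ_s)` nor to `ñ_s = (ℝ⁹, μ̃_s)`. -/
theorem statement17 (t s : ℝ) (ht : t ∈ Set.Ioi (1:ℝ)) (hs : s ∈ Set.Ioi (1:ℝ)) :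
    ¬ LieIso (muBar t) (mu s) ∧ ¬ LieIso (muBar t) (muTilde s) := by
  exact ⟨not_lieIso_muBar ht hs _ (fun _ _ ↦ rfl) (fun _ _ ↦ rfl),
    not_lieIso_muBar ht hs _ (muTilde_apply_seven s) (muTilde_apply_eight s)⟩
end
end
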